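/- Differential inequality in the maximum principle proof: for Q as in the advected Q-tensor equation with ζ > 0 and any η > 0, testing with 2(|Q|² − η)⁺ Q yields (1/2)(d/dt)∫_{𝕋²}|(|Q|²−η)⁺|² dx ≤ 2∫_{𝕋²}(3|L₄||Q| − ζ)|∇Q|²(|Q|²−η)⁺ dx + ∫_{𝕋²}(2|L₄||Q| − ζ)|∇(|Q|²−η)⁺|² dx − 2∫_{𝕋²}|Q|²(a + c|Q|²)(|Q|²−η)⁺ dx. -/

import Mathlib

open MeasureTheory

/-- Partial derivative in direction `i` of a function on `ℝ²`. -/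
noncomputable def pd (i : Fin 2) (f : (Fin 2 → ℝ) → ℝ) : (Fin 2 → ℝ) → ℝ :=
  fun x => fderiv ℝ f x (Pi.single i 1)

/-- The fundamental cell `[0,1]²` of the torus `𝕋²`. -/
def T2 : Set (Fin 2 → ℝ) := Set.univ.pi fun _ => Set.Icc (0:ℝ) 1

/-- `f` is `1`-periodic in each coordinate direction (i.e. lives on the torus `𝕋²`). -/
def Per (f : (Fin 2 → ℝ) → ℝ) : Prop :=
  ∀ (x : Fin 2 → ℝ) (i : Fin 2), f (x + Pi.single i 1) = f x


lemma fderiv_max_zero {E : Type*} [NormedAddCommGroup E] [NormedSpace ℝ E] {F : E → ℝ} {x : E}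
    (hF : ContinuousAt F x) :
    fderiv ℝ (fun y => max (F y) 0) x = if 0 < F x then fderiv ℝ F x else 0 := by
  split_ifs with h
  · apply Filter.EventuallyEq.fderiv_eq
    filter_upwards [hF.eventually_const_lt h] with y hy using max_eq_left hy.le
  · rw [not_lt] at h
    apply IsLocalMin.fderiv_eq_zero
    exact Filter.Eventually.of_forall fun y => by
      simp [max_eq_right h]

lemma pd_max_zero (k : Fin 2) {F : (Fin 2 → ℝ) → ℝ} (hF : Continuous F) (x : Fin 2 → ℝ) :
    pd k (fun y => max (F y) 0) x = {y | 0 < F y}.indicator (pd k F) x := by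
  simp only [pd, fderiv_max_zero hF.continuousAt, Set.indicator_apply, Set.mem_ofPred_eq]
  split_ifs <;> rfl

lemma deriv_max_zero {f : ℝ → ℝ} (hf : Continuous f) (s : ℝ) :
    deriv (fun r => max (f r) 0) s = if 0 < f s then deriv f s else 0 := by
  simp only [← fderiv_apply_one_eq_deriv, fderiv_max_zero hf.continuousAt]
  split_ifs <;> rfl

lemma ContDiff.absolutelyContinuousOnInterval {f : ℝ → ℝ} (hf : ContDiff ℝ 1 f) (a b : ℝ) :
    AbsolutelyContinuousOnInterval f a b := by
  obtain ⟨K, hK⟩ := hf.contDiffOn.exists_lipschitzOnWith (s := Set.uIcc a b) (by norm_num)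
    (convex_uIcc a b) isCompact_uIcc
  exact hK.absolutelyContinuousOnInterval

lemma AbsolutelyContinuousOnInterval.max_zero {f : ℝ → ℝ} (hf : ContDiff ℝ 1 f) (a b : ℝ) :
    AbsolutelyContinuousOnInterval (fun s => max (f s) 0) a b := by
  obtain ⟨K, hK⟩ := hf.contDiffOn.exists_lipschitzOnWith (s := Set.uIcc a b) (by norm_num)
    (convex_uIcc a b) isCompact_uIcc
  have : LipschitzOnWith (1 * K) (fun s => max (f s) 0) (Set.uIcc a b) :=
    (LipschitzWith.id.max_const 0).comp_lipschitzOnWith hK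
  exact this.absolutelyContinuousOnInterval

lemma intervalIntegral_indicator_pos_deriv_mul {f v : ℝ → ℝ} (hf : ContDiff ℝ 1 f)
    (hv : ContDiff ℝ 1 v) (a b : ℝ) :
    ∫ s in a..b, (if 0 < f s then deriv (fun r => f r * v r) s else 0)
      = max (f b) 0 * v b - max (f a) 0 * v a := by
  rw [← AbsolutelyContinuousOnInterval.integral_deriv_mul_eq_sub
    (AbsolutelyContinuousOnInterval.max_zero hf a b) (hv.absolutelyContinuousOnInterval a b)]
  congr 1
  ext s
  rw [deriv_max_zero hf.continuous,
    deriv_fun_mul (hf.differentiable one_ne_zero s) (hv.differentiable one_ne_zero s)]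
  split_ifs with h
  · rw [max_eq_left h.le]
  · rw [max_eq_right (not_lt.mp h)]; ring

lemma isCompact_T2 : IsCompact T2 := isCompact_univ_pi fun _ => isCompact_Icc

lemma measurableSet_T2 : MeasurableSet T2 := isCompact_T2.measurableSet

lemma Continuous.integrableOn_T2 {f : (Fin 2 → ℝ) → ℝ} (hf : Continuous f) :
    IntegrableOn f T2 := hf.continuousOn.integrableOn_compact isCompact_T2

lemma ContDiff.pd {n : WithTop ℕ∞} {f : (Fin 2 → ℝ) → ℝ} (hf : ContDiff ℝ (n + 1) f) (k : Fin 2) :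
    ContDiff ℝ n (pd k f) :=
  (hf.fderiv_right le_rfl).clm_apply contDiff_const

lemma integral_T2_indicator_pos_pd_mul (k : Fin 2) {F V : (Fin 2 → ℝ) → ℝ} (hF : ContDiff ℝ 1 F)
    (hV : ContDiff ℝ 1 V) (pF : Per F) (pV : Per V) :
    ∫ x in T2, {y | 0 < F y}.indicator (pd k (fun y => F y * V y)) x = 0 := by
  set g := {y | 0 < F y}.indicator (pd k (fun y => F y * V y)) with hg
  have hFV : ContDiff ℝ 1 (fun y => F y * V y) := hF.mul hV
  have hmp := (volume_preserving_piFinSuccAbove (fun _ : Fin 2 => ℝ) k).symm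
  set e := (MeasurableEquiv.piFinSuccAbove (fun _ : Fin 2 => ℝ) k).symm with he
  have hes (s : ℝ) (y : Fin 1 → ℝ) : e (s, y) = k.insertNth s y := rfl
  have hgi : IntegrableOn g T2 :=
    (ContDiff.pd (n := 0) (by simpa using hFV) k).continuous.integrableOn_T2.indicator
      (measurableSet_lt measurable_const hF.continuous.measurable)
  have hpre : e ⁻¹' T2 = Set.Icc (0:ℝ) 1 ×ˢ (Set.univ.pi fun _ : Fin 1 => Set.Icc (0:ℝ) 1) := by
    ext ⟨s, y⟩
    simp only [T2, Set.mem_preimage, Set.mem_univ_pi, Set.mem_prod]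
    rw [Fin.forall_iff_succAbove k, hes]
    simp
  have hgi' : IntegrableOn (fun z => g (e z))
      (Set.Icc (0:ℝ) 1 ×ˢ (Set.univ.pi fun _ : Fin 1 => Set.Icc (0:ℝ) 1)) := by
    rw [← hpre]
    exact (hmp.integrableOn_comp_preimage e.measurableEmbedding).mpr hgi
  rw [← hmp.setIntegral_preimage_emb e.measurableEmbedding, hpre]
  rw [IntegrableOn, Measure.volume_eq_prod, ← Measure.prod_restrict] at hgi'
  rw [Measure.volume_eq_prod, ← Measure.prod_restrict, integral_prod_symm _ hgi']
  refine integral_eq_zero_of_ae (Filter.Eventually.of_forall fun y => ?_)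
  have hline : ∀ s : ℝ, e (s, y) = e (0, y) + s • Pi.single k 1 := by
    intro s
    ext i
    induction i using Fin.succAboveCases k with
    | x => simp [hes]
    | p i => simp [hes]
  have hld : ContDiff ℝ 1 fun s : ℝ => e (0, y) + s • (Pi.single k 1 : Fin 2 → ℝ) := by fun_prop
  have hlh (s : ℝ) : HasDerivAt (fun s : ℝ => e (0, y) + s • (Pi.single k 1 : Fin 2 → ℝ))
      (Pi.single k 1) s := by
    simpa using ((hasDerivAt_id s).smul_const (Pi.single k (1:ℝ) : Fin 2 → ℝ)).const_add (e (0, y))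
  have key := intervalIntegral_indicator_pos_deriv_mul (hF.comp hld) (hV.comp hld) 0 1
  simp only [Function.comp_def, zero_smul, add_zero, one_smul, pF _ k, pV _ k, sub_self] at key
  change ∫ s in Set.Icc (0:ℝ) 1, g (e (s, y)) = 0
  rw [integral_Icc_eq_integral_Ioc, ← intervalIntegral.integral_of_le zero_le_one,
    ← key]
  congr 1
  ext s
  rw [hline s, hg, Set.indicator_apply]
  refine if_congr Iff.rfl ?_ rfl
  exact (((hFV.differentiable one_ne_zero _).hasFDerivAt.comp_hasDerivAt s (hlh s)).deriv).symm

lemma hasDerivAt_max_zero_sq (r : ℝ) : HasDerivAt (fun s : ℝ => (max s 0) ^ 2) (2 * max r 0) r := by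
  rcases lt_trichotomy r 0 with h | rfl | h
  · rw [max_eq_right h.le, mul_zero]
    refine (hasDerivAt_const r (0:ℝ)).congr_of_eventuallyEq ?_
    filter_upwards [Iio_mem_nhds h] with s hs
    simp [max_eq_right (Set.mem_Iio.mp hs).le]
  · rw [max_self, mul_zero, hasDerivAt_iff_hasFDerivAt]
    have : (fun s : ℝ => (max s 0) ^ 2) =O[nhds 0] fun s => ‖s - 0‖ ^ 2 := by
      refine Asymptotics.IsBigO.of_bound 1 (Filter.Eventually.of_forall fun s => ?_)
      rcases le_total s 0 with h | h
      · simp [max_eq_right h]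
        positivity
      · simp [max_eq_left h]
    simpa using this.hasFDerivAt one_lt_two
  · rw [max_eq_left h.le]
    refine (by simpa using hasDerivAt_pow 2 r : HasDerivAt (fun s : ℝ => s ^ 2) (2 * r) r)
      |>.congr_of_eventuallyEq ?_
    filter_upwards [Ioi_mem_nhds h] with s hs
    rw [max_eq_left (Set.mem_Ioi.mp hs).le]

lemma deriv_integral_T2_max_zero_sq {G : ℝ → (Fin 2 → ℝ) → ℝ}
    (hG : ContDiff ℝ 1 (fun p : ℝ × (Fin 2 → ℝ) => G p.1 p.2)) (t : ℝ) :
    IntegrableOn (fun x => 2 * max (G t x) 0 * deriv (fun s => G s x) t) T2 ∧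
    deriv (fun s => ∫ x in T2, (max (G s x) 0) ^ 2) t
      = ∫ x in T2, 2 * max (G t x) 0 * deriv (fun s => G s x) t := by
  have hd (x : Fin 2 → ℝ) (s : ℝ) : HasDerivAt (fun s => G s x)
      (fderiv ℝ (fun p : ℝ × (Fin 2 → ℝ) => G p.1 p.2) (s, x) (1, 0)) s :=
    HasFDerivAt.comp_hasDerivAt (l := fun p : ℝ × (Fin 2 → ℝ) => G p.1 p.2)
      (f := fun s => (s, x)) s (hG.differentiable one_ne_zero (s, x)).hasFDerivAt
      ((hasDerivAt_id s).prodMk (hasDerivAt_const s x))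
  have hGc (s : ℝ) : Continuous (G s) := hG.continuous.comp (by fun_prop : Continuous fun x => (s, x))
  have hdc : Continuous fun p : ℝ × (Fin 2 → ℝ) =>
      2 * max (G p.1 p.2) 0 *
        fderiv ℝ (fun p : ℝ × (Fin 2 → ℝ) => G p.1 p.2) p (1, 0) := by
    have h1 := hG.continuous
    have h2 := hG.continuous_fderiv one_ne_zero
    fun_prop
  obtain ⟨C, hC⟩ := ((isCompact_Icc (a := t - 1) (b := t + 1)).prod
    isCompact_T2).exists_bound_of_continuousOn hdc.continuousOn
  simp only [(hd _ t).deriv]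
  refine (fun h => ⟨h.1, h.2.deriv⟩) (hasDerivAt_integral_of_dominated_loc_of_deriv_le (bound := fun _ => C)
    (F := fun s x => (max (G s x) 0) ^ 2)
    (F' := fun s x => 2 * max (G s x) 0 *
        fderiv ℝ (fun p : ℝ × (Fin 2 → ℝ) => G p.1 p.2) (s, x) (1, 0))
    (Icc_mem_nhds (by linarith : t - 1 < t) (by linarith : t < t + 1)) ?_ ?_ ?_ ?_ ?_ ?_)
  · exact Filter.Eventually.of_forall fun s =>
      (((hGc s).max continuous_const).pow 2).aestronglyMeasurable
  · exact (((hGc t).max continuous_const).pow 2).integrableOn_T2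
  · exact (hdc.comp (by fun_prop : Continuous fun x => (t, x))).aestronglyMeasurable
  · filter_upwards [ae_restrict_mem measurableSet_T2] with x hx s hs
    exact hC (s, x) ⟨hs, hx⟩
  · exact continuous_const.integrableOn_T2
  · exact Filter.Eventually.of_forall fun x s _ =>
      HasDerivAt.comp (h₂ := fun r : ℝ => (max r 0) ^ 2) s (hasDerivAt_max_zero_sq (G s x)) (hd x s)

lemma Per.pd {f : (Fin 2 → ℝ) → ℝ} (hf : Per f) (k : Fin 2) : Per (pd k f) := by
  intro x i
  simp only [_root_.pd]
  rw [← fderiv_comp_add_right, show (fun y => f (y + Pi.single i 1)) = f from funext fun y => hf y i]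

lemma pd_mul (k : Fin 2) {f g : (Fin 2 → ℝ) → ℝ} {x : Fin 2 → ℝ} (hf : DifferentiableAt ℝ f x)
    (hg : DifferentiableAt ℝ g x) :
    pd k (fun y => f y * g y) x = f x * pd k g x + g x * pd k f x := by
  simp [pd, fderiv_fun_mul hf hg]

lemma pd_add (k : Fin 2) {f g : (Fin 2 → ℝ) → ℝ} {x : Fin 2 → ℝ} (hf : DifferentiableAt ℝ f x)
    (hg : DifferentiableAt ℝ g x) :
    pd k (fun y => f y + g y) x = pd k f x + pd k g x := by
  simp [pd, fderiv_fun_add hf hg]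

lemma pd_sum {ι : Type*} (k : Fin 2) (s : Finset ι) {f : ι → (Fin 2 → ℝ) → ℝ} {x : Fin 2 → ℝ}
    (hf : ∀ i ∈ s, DifferentiableAt ℝ (f i) x) :
    pd k (fun y => ∑ i ∈ s, f i y) x = ∑ i ∈ s, pd k (f i) x := by
  simp [pd, fderiv_fun_sum hf]

lemma abs_sum_mul_mul_le {ι : Type*} [Fintype ι] (q : ι → ι → ℝ) (v : ι → ℝ) :
    |∑ k, ∑ l, v k * v l * q l k| ≤ √(∑ i, ∑ j, (q i j) ^ 2) * ∑ k, (v k) ^ 2 := by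
  have hv : 0 ≤ ∑ k, (v k) ^ 2 := Finset.sum_nonneg fun _ _ => sq_nonneg _
  rw [← Real.sqrt_sq hv, ← Real.sqrt_mul (Finset.sum_nonneg fun _ _ =>
    Finset.sum_nonneg fun _ _ => sq_nonneg _)]
  apply Real.abs_le_sqrt
  have := Finset.sum_mul_sq_le_sq_mul_sq (Finset.univ : Finset (ι × ι))
    (fun p => q p.2 p.1) (fun p => v p.1 * v p.2)
  simp only [Fintype.sum_prod_type, mul_pow] at this
  rw [Finset.sum_comm (f := fun k l => q l k ^ 2)] at this
  rw [sq (∑ k, v k ^ 2), Finset.sum_mul_sum]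
  simpa only [mul_comm] using this

lemma pd_normSq (k : Fin 2) (η : ℝ) {q : Fin 2 → Fin 2 → (Fin 2 → ℝ) → ℝ} {x : Fin 2 → ℝ}
    (hq : ∀ i j, DifferentiableAt ℝ (q i j) x) :
    pd k (fun y => (∑ i, ∑ j, (q i j y) ^ 2) - η) x = ∑ i, ∑ j, 2 * q i j x * pd k (q i j) x := by
  have h : HasFDerivAt (fun y => (∑ i, ∑ j, (q i j y) ^ 2) - η)
      (∑ i, ∑ j, (2 * q i j x) • fderiv ℝ (q i j) x) x := by
    refine HasFDerivAt.sub_const η (HasFDerivAt.fun_sum fun i _ => HasFDerivAt.fun_sum fun j _ => ?_)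
    simpa using (hq i j).hasFDerivAt.pow 2
  rw [pd, h.fderiv]
  simp [pd]

lemma pd_const_mul (k : Fin 2) (r : ℝ) {g : (Fin 2 → ℝ) → ℝ} {x : Fin 2 → ℝ}
    (hg : DifferentiableAt ℝ g x) : pd k (fun y => r * g y) x = r * pd k g x := by
  simp [pd, fderiv_const_mul hg]

lemma pd_flux (k : Fin 2) {q w : Fin 2 → Fin 2 → (Fin 2 → ℝ) → ℝ}
    {v : (Fin 2 → ℝ) → ℝ} {x : Fin 2 → ℝ}
    (hq : ∀ i j, DifferentiableAt ℝ (q i j) x) (hw : ∀ i j, DifferentiableAt ℝ (w i j) x)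
    (hv : DifferentiableAt ℝ v x) {F : (Fin 2 → ℝ) → ℝ} (hFd : DifferentiableAt ℝ F x) :
    pd k (fun y => F y * (-(1 / 2) * (F y * v y) + ∑ i, ∑ j, 2 * (q i j y * w i j y))) x
      = -(F x * pd k F x * v x) - F x ^ 2 / 2 * pd k v x
        + pd k F x * (∑ i, ∑ j, 2 * (q i j x * w i j x))
        + F x * ∑ i, ∑ j, 2 * (q i j x * pd k (w i j) x + w i j x * pd k (q i j) x) := by
  rw [pd_mul k hFd (by fun_prop), pd_add k (by fun_prop) (by fun_prop), pd_const_mul k _ (by fun_prop),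
    pd_mul k hFd hv, pd_sum k _ (fun i _ => by fun_prop)]
  have : ∀ i, pd k (fun y => ∑ j, 2 * (q i j y * w i j y)) x
      = ∑ j, 2 * (q i j x * pd k (w i j) x + w i j x * pd k (q i j) x) := fun i => by
    rw [pd_sum k _ (fun j _ => by fun_prop)]
    exact Finset.sum_congr rfl fun j _ => by rw [pd_const_mul k _ (by fun_prop), pd_mul k (hq i j) (hw i j)]
  simp only [this]
  ring

lemma energy_density_le {ζ L a c : ℝ} {q D : Fin 2 → Fin 2 → ℝ}
    {A H M : Fin 2 → Fin 2 → Fin 2 → ℝ} {U : Fin 2 → ℝ} {W : Fin 2 → Fin 2 → ℝ}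
    (hsym : q 1 0 = q 0 1) (htr : q 1 1 = -q 0 0) (hdiv : ∑ k, W k k = 0)
    (heq : ∀ i j, D i j + (∑ k, U k * A i j k)
        + (∑ k, (q i k * ((W k j - W j k) / 2) - ((W i k - W k i) / 2) * q k j))
      = ζ * (∑ k, H i j k) + 2 * L * (∑ k, M i j k) - L * (∑ k, ∑ l, A k l i * A k l j)
        + (L / 2) * (∑ m, ∑ k, ∑ l, (A k l m) ^ 2) * (if i = j then 1 else 0)
        - a * q i j - c * (∑ i, ∑ j, q i j * q j i) * q i j)
    {f N : ℝ} {dF : Fin 2 → ℝ} (hN : N = ∑ i, ∑ j, (q i j) ^ 2) (hf0 : 0 < f)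
    (hdF : ∀ k, dF k = ∑ i, ∑ j, 2 * q i j * A i j k) :
    f * (∑ i, ∑ j, 2 * q i j * D i j) ≤
      (∑ k, (-(f * dF k * U k) - f ^ 2 / 2 * W k k
        + dF k * (∑ i, ∑ j, 2 * (q i j * (ζ * A i j k + 2 * L * ∑ l, A i j l * q l k)))
        + f * ∑ i, ∑ j, 2 * (q i j * (ζ * H i j k + 2 * L * M i j k)
          + (ζ * A i j k + 2 * L * ∑ l, A i j l * q l k) * A i j k)))
      + (2 * ((3 * |L| * √N - ζ) * (∑ m, ∑ k, ∑ l, (A k l m) ^ 2) * f)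
        + (2 * |L| * √N - ζ) * (∑ k, (dF k) ^ 2)
        - 2 * (N * (a + c * N) * f)) := by
  have hL (s b : ℝ) (h : |s| ≤ √N * b) : -(L * s) ≤ |L| * (√N * b) :=
    (neg_le_abs _).trans (by rw [abs_mul]; gcongr)
  have hA (i j : Fin 2) := hL _ _ (hN ▸ abs_sum_mul_mul_le q (A i j))
  have hA' := mul_le_mul_of_nonneg_left
    (add_le_add (add_le_add (hA 0 0) (hA 0 1)) (add_le_add (hA 1 0) (hA 1 1))) hf0.le
  have hF' := hL _ _ (hN ▸ abs_sum_mul_mul_le q dF)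
  have h00 := heq 0 0
  have h01 := heq 0 1
  have h10 := heq 1 0
  have h11 := heq 1 1
  obtain rfl : dF = fun k => ∑ i, ∑ j, 2 * q i j * A i j k := funext hdF
  clear hdF heq hA hL
  simp only [Fin.sum_univ_two, hsym, htr, Fin.isValue, if_true, one_ne_zero, zero_ne_one, if_false]
    at *
  linear_combination 6 * hA' + 2 * hF' + 2 * f * q 0 0 * h00 + 2 * f * q 0 1 * h01
    + 2 * f * q 0 1 * h10 - 2 * f * q 0 0 * h11 + f ^ 2 / 2 * hdiv
    + (2 * a * f + 2 * c * f * (N + 2 * (q 0 0 ^ 2 + q 0 1 ^ 2))) * hN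

/-- Differential inequality in the maximum principle proof: for a sufficiently regular
solution `Q` of the advected Q-tensor equation (with `u` divergence-free and
`ω = (∇u − (∇u)ᵀ)/2`), testing with `2(|Q|² − η)⁺ Q` yields, for every `t ∈ [0,T]`,
`(1/2)(d/dt)∫ |(|Q|²−η)⁺|² ≤ 2∫ (3|L₄||Q| − ζ)|∇Q|²(|Q|²−η)⁺`
`+ ∫ (2|L₄||Q| − ζ)|∇(|Q|²−η)⁺|² − 2∫ |Q|²(a + c|Q|²)(|Q|²−η)⁺`. -/
theorem maximum_principle_differential_inequality (T ζ L₄ a c η : ℝ)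
    (hT : 0 ≤ T) (hζ : 0 < ζ) (hη : 0 < η)
    (u : ℝ → (Fin 2 → ℝ) → Fin 2 → ℝ)
    (Q : ℝ → (Fin 2 → ℝ) → Matrix (Fin 2) (Fin 2) ℝ)
    (hu : ∀ i, ContDiff ℝ (⊤ : ℕ∞) (fun p : ℝ × (Fin 2 → ℝ) => u p.1 p.2 i))
    (hup : ∀ t i, Per (fun x => u t x i))
    (hdiv : ∀ t x, ∑ k, pd k (fun y => u t y k) x = 0)
    (hQ : ∀ i j, ContDiff ℝ (⊤ : ℕ∞) (fun p : ℝ × (Fin 2 → ℝ) => Q p.1 p.2 i j))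
    (hQp : ∀ t i j, Per (fun x => Q t x i j))
    (hsym : ∀ t x, (Q t x).IsSymm) (htr : ∀ t x, (Q t x).trace = 0)
    (heq : ∀ t ∈ Set.Icc (0:ℝ) T, ∀ (x : Fin 2 → ℝ) (i j : Fin 2),
      deriv (fun s => Q s x i j) t
        + (∑ k, u t x k * pd k (fun y => Q t y i j) x)
        + (∑ k, (Q t x i k
              * ((pd j (fun y => u t y k) x - pd k (fun y => u t y j) x) / 2)
            - ((pd k (fun y => u t y i) x - pd i (fun y => u t y k) x) / 2)
              * Q t x k j))
      = ζ * (∑ k, pd k (pd k (fun y => Q t y i j)) x)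
        + 2 * L₄ * (∑ k, pd k (fun y =>
            ∑ l, pd l (fun z => Q t z i j) y * Q t y l k) x)
        - L₄ * (∑ k, ∑ l,
            pd i (fun z => Q t z k l) x * pd j (fun z => Q t z k l) x)
        + (L₄ / 2) * (∑ m, ∑ k, ∑ l, (pd m (fun z => Q t z k l) x)^2)
            * (if i = j then 1 else 0)
        - a * Q t x i j - c * (Q t x * Q t x).trace * Q t x i j) :
    ∀ t ∈ Set.Icc (0:ℝ) T,
      (1/2) * deriv (fun s =>
          ∫ x in T2, (max ((∑ i, ∑ j, (Q s x i j)^2) - η) 0)^2) t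
        ≤ 2 * (∫ x in T2,
              (3 * |L₄| * Real.sqrt (∑ i, ∑ j, (Q t x i j)^2) - ζ)
                * (∑ m, ∑ k, ∑ l, (pd m (fun z => Q t z k l) x)^2)
                * max ((∑ i, ∑ j, (Q t x i j)^2) - η) 0)
          + (∫ x in T2,
              (2 * |L₄| * Real.sqrt (∑ i, ∑ j, (Q t x i j)^2) - ζ)
                * (∑ k, (pd k (fun y =>
                    max ((∑ i, ∑ j, (Q t y i j)^2) - η) 0) x)^2))
          - 2 * ∫ x in T2,
              (∑ i, ∑ j, (Q t x i j)^2)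
                * (a + c * (∑ i, ∑ j, (Q t x i j)^2))
                * max ((∑ i, ∑ j, (Q t x i j)^2) - η) 0 := by
  intro t ht
  have hpt (f : ℝ → (Fin 2 → ℝ) → ℝ)
      (hf : ContDiff ℝ (⊤ : ℕ∞) (fun p : ℝ × (Fin 2 → ℝ) => f p.1 p.2)) :
      ContDiff ℝ (⊤ : ℕ∞) (f t) :=
    ContDiff.comp (g := fun p : ℝ × (Fin 2 → ℝ) => f p.1 p.2) hf
      (by fun_prop : ContDiff ℝ (⊤ : ℕ∞) fun x : Fin 2 → ℝ => (t, x))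
  let q : Fin 2 → Fin 2 → (Fin 2 → ℝ) → ℝ := fun i j y => Q t y i j
  let v : Fin 2 → (Fin 2 → ℝ) → ℝ := fun k y => u t y k
  let F : (Fin 2 → ℝ) → ℝ := fun y => (∑ i, ∑ j, (q i j y) ^ 2) - η
  let Y : Fin 2 → Fin 2 → Fin 2 → (Fin 2 → ℝ) → ℝ :=
    fun i j k y => ∑ l, pd l (q i j) y * q l k y
  let w : Fin 2 → Fin 2 → Fin 2 → (Fin 2 → ℝ) → ℝ :=
    fun i j k y => ζ * pd k (q i j) y + 2 * L₄ * Y i j k y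
  let V : Fin 2 → (Fin 2 → ℝ) → ℝ :=
    fun k y => -(1 / 2) * (F y * v k y) + ∑ i, ∑ j, 2 * (q i j y * w i j k y)
  have hq (i j : Fin 2) : ContDiff ℝ (⊤ : ℕ∞) (q i j) := hpt (fun s x => Q s x i j) (hQ i j)
  have hv (k : Fin 2) : ContDiff ℝ (⊤ : ℕ∞) (v k) := hpt (fun s x => u s x k) (hu k)
  have hpq (i j k : Fin 2) : ContDiff ℝ (⊤ : ℕ∞) (pd k (q i j)) := (hq i j).pd k
  have hF : ContDiff ℝ (⊤ : ℕ∞) F := by fun_prop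
  have hY (i j k : Fin 2) : ContDiff ℝ (⊤ : ℕ∞) (Y i j k) := by fun_prop
  have hw (i j k : Fin 2) : ContDiff ℝ (⊤ : ℕ∞) (w i j k) := by fun_prop
  have hV (k : Fin 2) : ContDiff ℝ (⊤ : ℕ∞) (V k) := by fun_prop
  have hFV (k : Fin 2) : ContDiff ℝ (⊤ : ℕ∞) (fun y => F y * V k y) := hF.mul (hV k)
  have pq (i j : Fin 2) : Per (q i j) := hQp t i j
  have pF : Per F := fun x m => by simp only [F, pq _ _ x m]
  have pV (k : Fin 2) : Per (V k) := fun x m => by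
    simp only [V, w, Y, pF x m, pq _ _ x m, ((pq _ _).pd _) x m, v, hup t k x m]
  have hqd (i j : Fin 2) (x : Fin 2 → ℝ) : DifferentiableAt ℝ (q i j) x :=
    (hq i j).differentiable (by simp) x
  have hdF (k : Fin 2) (x : Fin 2 → ℝ) :
      pd k F x = ∑ i, ∑ j, 2 * q i j x * pd k (q i j) x := pd_normSq k η fun i j => hqd i j x
  have hw' (i j k : Fin 2) (x : Fin 2 → ℝ) :
      pd k (w i j k) x = ζ * pd k (pd k (q i j)) x + 2 * L₄ * pd k (Y i j k) x := by
    have h1 : DifferentiableAt ℝ (pd k (q i j)) x := (hpq i j k).differentiable (by simp) x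
    have h2 : DifferentiableAt ℝ (Y i j k) x := (hY i j k).differentiable (by simp) x
    rw [pd_add k (by fun_prop) (by fun_prop), pd_const_mul k _ h1, pd_const_mul k _ h2]
  have hflux (k : Fin 2) (x : Fin 2 → ℝ) := pd_flux k (fun i j => hqd i j x)
    (fun i j => (hw i j k).differentiable (by simp) x) ((hv k).differentiable (by simp) x)
    (hF.differentiable (by simp) x)
  have hdt (x : Fin 2 → ℝ) : deriv (fun s => (∑ i, ∑ j, (Q s x i j) ^ 2) - η) t
      = ∑ i, ∑ j, 2 * q i j x * deriv (fun s => Q s x i j) t := by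
    have hQd (i j : Fin 2) : DifferentiableAt ℝ (fun s => Q s x i j) t :=
      (ContDiff.comp (g := fun p : ℝ × (Fin 2 → ℝ) => Q p.1 p.2 i j) (hQ i j)
        (by fun_prop : ContDiff ℝ (⊤ : ℕ∞) fun s : ℝ => (s, x))).differentiable (by simp) t
    refine (HasDerivAt.sub_const η (HasDerivAt.fun_sum fun i _ => HasDerivAt.fun_sum fun j _ =>
      ?_)).deriv
    simpa using (hQd i j).hasDerivAt.fun_pow 2
  have hmeas : MeasurableSet {y | 0 < F y} :=
    measurableSet_lt measurable_const hF.continuous.measurable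
  have hden (x : Fin 2 → ℝ) :
      max (F x) 0 * deriv (fun s => (∑ i, ∑ j, (Q s x i j) ^ 2) - η) t
      ≤ (∑ k, {y | 0 < F y}.indicator (pd k (fun y => F y * V k y)) x)
        + (2 * ((3 * |L₄| * √(∑ i, ∑ j, (q i j x) ^ 2) - ζ)
            * (∑ m, ∑ k, ∑ l, (pd m (q k l) x) ^ 2) * max (F x) 0)
          + (2 * |L₄| * √(∑ i, ∑ j, (q i j x) ^ 2) - ζ)
            * (∑ k, (pd k (fun y => max (F y) 0) x) ^ 2)
          - 2 * ((∑ i, ∑ j, (q i j x) ^ 2) * (a + c * (∑ i, ∑ j, (q i j x) ^ 2))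
            * max (F x) 0)) := by
    simp only [pd_max_zero _ hF.continuous, Set.indicator_apply, Set.mem_ofPred_eq]
    by_cases h : 0 < F x
    · simp only [h, if_true, max_eq_left h.le]
      rw [hdt]
      simp only [V, hflux, hw']
      refine energy_density_le (U := fun k => v k x) (W := fun k j => pd j (v k) x)
        ((hsym t x).apply 0 1) ?_ (hdiv t x) (fun i j => ?_) rfl h fun k => hdF k x
      · have := htr t x
        rw [Matrix.trace_fin_two] at this
        linear_combination this
      · have := heq t ht x i j
        simp only [Matrix.trace, Matrix.diag_apply, Matrix.mul_apply] at this
        exact this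
    · simp [h, max_eq_right (not_lt.mp h)]
  obtain ⟨hi, hderiv⟩ := deriv_integral_T2_max_zero_sq
    (G := fun s x => (∑ i, ∑ j, (Q s x i j) ^ 2) - η) (by
      have hQ1 (i j : Fin 2) : ContDiff ℝ 1 (fun p : ℝ × (Fin 2 → ℝ) => Q p.1 p.2 i j) :=
        (hQ i j).of_le (by simp)
      fun_prop) t
  rw [hderiv]
  have hqc (i j : Fin 2) : Continuous (q i j) := (hq i j).continuous
  have hpqc (i j k : Fin 2) : Continuous (pd k (q i j)) := (hpq i j k).continuous
  have hFc : Continuous F := hF.continuous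
  have hI0 (k : Fin 2) :
      IntegrableOn (fun x => {y | 0 < F y}.indicator (pd k (fun y => F y * V k y)) x) T2 :=
    ((hFV k).pd (n := (⊤ : ℕ∞)) k).continuous.integrableOn_T2.indicator hmeas
  have hI1 : IntegrableOn (fun x => (3 * |L₄| * √(∑ i, ∑ j, (q i j x) ^ 2) - ζ)
      * (∑ m, ∑ k, ∑ l, (pd m (q k l) x) ^ 2) * max (F x) 0) T2 :=
    Continuous.integrableOn_T2 (by fun_prop)
  have hI2 : IntegrableOn (fun x => (2 * |L₄| * √(∑ i, ∑ j, (q i j x) ^ 2) - ζ)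
      * (∑ k, (pd k (fun y => max (F y) 0) x) ^ 2)) T2 := by
    have hc : Continuous fun x => (2 * |L₄| * √(∑ i, ∑ j, (q i j x) ^ 2) - ζ)
      * (∑ k, (pd k F x) ^ 2) := by
      have (k : Fin 2) : Continuous (pd k F) := (hF.pd (n := (⊤ : ℕ∞)) k).continuous
      fun_prop
    refine (hc.integrableOn_T2.indicator hmeas).congr_fun (fun x _ => ?_) measurableSet_T2
    simp only [pd_max_zero _ hFc, Set.indicator_apply]
    split_ifs <;> simp
  have hI3 : IntegrableOn (fun x => (∑ i, ∑ j, (q i j x) ^ 2)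
      * (a + c * (∑ i, ∑ j, (q i j x) ^ 2)) * max (F x) 0) T2 :=
    Continuous.integrableOn_T2 (by fun_prop)
  have hIs := integrable_finsetSum Finset.univ fun k _ => hI0 k
  calc (1 / 2) * ∫ x in T2, 2 * max (F x) 0
        * deriv (fun s => (∑ i, ∑ j, (Q s x i j) ^ 2) - η) t
      = ∫ x in T2, max (F x) 0 * deriv (fun s => (∑ i, ∑ j, (Q s x i j) ^ 2) - η) t := by
        rw [← integral_const_mul]
        exact integral_congr_ae (Filter.Eventually.of_forall fun x => by ring)
    _ ≤ _ := integral_mono ((hi.const_mul (1 / 2)).congr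
          (Filter.Eventually.of_forall fun x => by simp only [F, q]; ring))
          (hIs.add (((hI1.const_mul 2).add hI2).sub (hI3.const_mul 2))) hden
    _ = _ := by
        rw [integral_add' hIs (((hI1.const_mul 2).add hI2).sub (hI3.const_mul 2)),
          integral_sub' ((hI1.const_mul 2).add hI2) (hI3.const_mul 2),
          integral_add' (hI1.const_mul 2) hI2, integral_const_mul, integral_const_mul,
          integral_finsetSum _ fun k _ => hI0 k]
        simp only [integral_T2_indicator_pos_pd_mul _ (hF.of_le (by simp))
          ((hV _).of_le (by simp)) pF (pV _), Finset.sum_const_zero, zero_add]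
        rfl
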